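/- Fix h in the interior of ℋ := conv{γ_1,…,γ_d}, and let η be a Borel probability measure on 𝒴_h := {y ∈ ℝ^{d−1} : 1 + (γ_i − h)ᵀy ≥ 0 for all i} with ∫ y dη(y) = 0. Define ρ := (S_h)_#((1 − hᵀy) η(dy)), where S_h(y) := y/(1 − hᵀy). Then ρ is an anchored law, its fiber satisfies (T_h)_#((1 + hᵀx) ρ(dx)) = η where T_h(x) := x/(1 + hᵀx), and ρ is the unique anchored law whose fiber at h equals η. -/

import Mathlib

open Finset MeasureTheory
open scoped ENNReal

lemma roundtrip_aux {E : Type*} [MeasurableSpace E] (μ : Measure E) (u v : E → ℝ≥0∞) (S T : E → E)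
    (hu : Measurable u) (hv : Measurable v) (hS : Measurable S) (hT : Measurable T)
    (hTS : ∀ᵐ y ∂μ, T (S y) = y) (huv : ∀ᵐ y ∂μ, u y * v (S y) = 1) :
    ((((μ.withDensity u).map S).withDensity v).map T) = μ := by
  ext A hA
  have h1 : MeasurableSet (T ⁻¹' A) := hT hA
  have h2 : MeasurableSet (S ⁻¹' (T ⁻¹' A)) := hS h1
  rw [Measure.map_apply hT hA, withDensity_apply _ h1, setLIntegral_map h1 hv hS]
  change ∫⁻ x in S ⁻¹' (T ⁻¹' A), (v ∘ S) x ∂μ.withDensity u = μ A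
  rw [setLIntegral_withDensity_eq_setLIntegral_mul _ hu (hv.comp hS) h2]
  rw [← lintegral_indicator h2, ← lintegral_indicator_one hA]
  apply lintegral_congr_ae
  filter_upwards [hTS, huv] with y a b
  have hm : y ∈ S ⁻¹' (T ⁻¹' A) ↔ y ∈ A := by
    rw [Set.mem_preimage, Set.mem_preimage, a]
  by_cases hy : y ∈ A
  · rw [Set.indicator_of_mem (hm.2 hy), Set.indicator_of_mem hy]
    exact b
  · rw [Set.indicator_of_notMem (fun c => hy (hm.1 c)), Set.indicator_of_notMem hy]

lemma hull_aux {ι n : Type*} [Fintype n] (g : ι → n → ℝ) (c : ℝ) (x : n → ℝ)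
    (hx : ∀ i, 0 ≤ c + ∑ j, g i j * x j) (k : n → ℝ) (hk : k ∈ convexHull ℝ (Set.range g)) :
    0 ≤ c + ∑ j, k j * x j := by
  have hc : Convex ℝ {k : n → ℝ | 0 ≤ c + ∑ j, k j * x j} := by
    intro a ha b hb s t hs ht hst
    simp only [Set.mem_ofPred_eq] at ha hb ⊢
    have : c + ∑ j, (s • a + t • b) j * x j
        = s * (c + ∑ j, a j * x j) + t * (c + ∑ j, b j * x j) := by
      simp only [Pi.add_apply, Pi.smul_apply, smul_eq_mul, add_mul, Finset.sum_add_distrib,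
        mul_add, Finset.mul_sum, mul_assoc]
      linear_combination (-c) * hst
    rw [this]
    positivity
  exact convexHull_min (by rintro _ ⟨i, rfl⟩; exact hx i) hc hk

/-- Fix `h` in the interior of `ℋ = conv{γ₁,…,γ_d}` and let `η` be a
Borel probability measure on `𝒴_h = {y : 1 + (γᵢ - h)ᵀy ≥ 0 ∀ i}` with mean zero.
Then `ρ := (S_h)_# ((1 - hᵀy) η(dy))`, with `S_h(y) = y/(1 - hᵀy)`, is an anchored law,
its fiber `(T_h)_# ((1 + hᵀx) ρ(dx))` equals `η` (where `T_h(x) = x/(1 + hᵀx)`), and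
`ρ` is the unique anchored law whose fiber at `h` is `η`. -/
theorem stmt5 (d : ℕ) (hd : 2 ≤ d)
    (H : Matrix (Fin d) (Fin (d - 1)) ℝ)
    (horth : H.transpose * H = 1)
    (hcolsum : ∀ j, ∑ i, H i j = 0)
    (h : Fin (d - 1) → ℝ)
    (hh : h ∈ interior (convexHull ℝ (Set.range fun i : Fin d => fun j => H i j)))
    (η : Measure (Fin (d - 1) → ℝ)) [IsProbabilityMeasure η]
    (hηsupp : η {y | ∀ i, 0 ≤ 1 + ∑ j, (H i j - h j) * y j}ᶜ = 0)
    (hηmean : ∫ y, y ∂η = 0) :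
    let 𝒳 : Set (Fin (d - 1) → ℝ) := {x | ∀ i, 0 ≤ 1 + ∑ j, H i j * x j}
    let S : (Fin (d - 1) → ℝ) → (Fin (d - 1) → ℝ) := fun y => (1 - ∑ j, h j * y j)⁻¹ • y
    let T : (Fin (d - 1) → ℝ) → (Fin (d - 1) → ℝ) := fun x => (1 + ∑ j, h j * x j)⁻¹ • x
    let ρ : Measure (Fin (d - 1) → ℝ) :=
      (η.withDensity fun y => ENNReal.ofReal (1 - ∑ j, h j * y j)).map S
    let fiber : Measure (Fin (d - 1) → ℝ) → Measure (Fin (d - 1) → ℝ) :=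
      fun μ => (μ.withDensity fun x => ENNReal.ofReal (1 + ∑ j, h j * x j)).map T
    IsProbabilityMeasure ρ ∧
    ρ 𝒳ᶜ = 0 ∧
    (∫ x, x ∂ρ = 0) ∧
    fiber ρ = η ∧
    (∀ ρ' : Measure (Fin (d - 1) → ℝ), IsProbabilityMeasure ρ' → ρ' 𝒳ᶜ = 0 →
      (∫ x, x ∂ρ' = 0) → fiber ρ' = η → ρ' = ρ) := by
  intro 𝒳 S T ρ fiber
  obtain ⟨ε, hε, hball⟩ := Metric.mem_nhds_iff.1 (mem_interior_iff_mem_nhds.1 hh)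
  -- positivity on 𝒳
  have hXpos : ∀ x ∈ 𝒳, 0 < 1 + ∑ j, h j * x j := by
    intro x hx
    have hcont : Filter.Tendsto (fun t : ℝ => h - t • x) (nhdsWithin 0 (Set.Ioi 0)) (nhds h) := by
      have : Continuous (fun t : ℝ => h - t • x) := by fun_prop
      have := this.tendsto 0
      simp only [zero_smul, sub_zero] at this
      exact this.mono_left nhdsWithin_le_nhds
    have hev := hcont.eventually (Metric.ball_mem_nhds h hε)
    obtain ⟨t, ht1, ht2⟩ := (hev.and self_mem_nhdsWithin).exists
    have ht2 : 0 < t := ht2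
    have key := hull_aux _ 1 x hx _ (hball ht1)
    have e : 1 + ∑ j, (h - t • x) j * x j = (1 + ∑ j, h j * x j) - t * ∑ j, x j * x j := by
      simp only [Pi.sub_apply, Pi.smul_apply, smul_eq_mul, sub_mul, Finset.sum_sub_distrib,
        Finset.mul_sum, mul_assoc]
      ring
    rw [e] at key
    have hn : 0 ≤ ∑ j, x j * x j := Finset.sum_nonneg fun j _ => mul_self_nonneg _
    rcases hn.eq_or_lt with h0 | h0
    · have hx0 : ∀ j, x j = 0 := fun j => by
        have := (Finset.sum_eq_zero_iff_of_nonneg (fun j _ => mul_self_nonneg (x j))).1 h0.symm j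
          (Finset.mem_univ _)
        simpa using this
      simp [hx0]
    · have := mul_pos ht2 h0
      linarith
  have hsplit : ∀ (y : Fin (d - 1) → ℝ) (k : Fin (d - 1) → ℝ), 1 + ∑ j, (k j - h j) * y j
      = (1 - ∑ j, h j * y j) + ∑ j, k j * y j := by
    intro y k
    simp only [sub_mul, Finset.sum_sub_distrib]
    ring
  have hYpos : ∀ y : Fin (d - 1) → ℝ, (∀ i, 0 ≤ 1 + ∑ j, (H i j - h j) * y j) →
      0 < 1 - ∑ j, h j * y j := by
    intro y hy
    simp only [hsplit y (H _)] at hy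
    have hsum : ∑ i, ∑ j, H i j * y j = 0 := by
      rw [Finset.sum_comm]
      simp [← Finset.sum_mul, hcolsum]
    have h0 : 0 ≤ (d : ℝ) * (1 - ∑ j, h j * y j) := by
      have := Finset.sum_nonneg (s := Finset.univ) fun i _ => hy i
      rw [Finset.sum_add_distrib, hsum, Finset.sum_const, Finset.card_univ, Fintype.card_fin,
        nsmul_eq_mul, add_zero] at this
      exact this
    have hdpos : (0 : ℝ) < d := by exact_mod_cast (by omega : 0 < d)
    have h0 := nonneg_of_mul_nonneg_right h0 hdpos
    rcases h0.eq_or_lt with h1 | h1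
    · exfalso
      simp only [← h1, zero_add] at hy
      have hz := (Finset.sum_eq_zero_iff_of_nonneg (fun i _ => hy i)).1 hsum
      have hHy : H.mulVec y = 0 := by
        ext i
        exact hz i (Finset.mem_univ _)
      have : y = 0 := by
        have := congrArg (H.transpose.mulVec) hHy
        simpa [Matrix.mulVec_mulVec, horth] using this
      simp [this] at h1
    · exact h1
  have hYbd : ∀ y : Fin (d - 1) → ℝ, (∀ i, 0 ≤ 1 + ∑ j, (H i j - h j) * y j) →
      ‖y‖ ≤ 2 / ε := by
    intro y hy
    simp only [hsplit y (H _)] at hy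
    have gen : ∀ (j : Fin (d - 1)) (s : ℝ), |s| < ε → 0 ≤ 1 + s * y j := by
      intro j s hs
      have hm : h + Pi.single j s ∈ Metric.ball h ε := by
        rw [mem_ball_iff_norm]
        simpa [Pi.norm_single] using hs
      have := hull_aux _ _ y hy _ (hball hm)
      rw [← hsplit y] at this
      simpa [Pi.single_apply, ite_mul] using this
    rw [pi_norm_le_iff_of_nonneg (by positivity)]
    intro j
    have a := gen j (ε / 2) (by rw [abs_of_pos (by positivity)]; linarith)
    have b := gen j (-(ε / 2)) (by rw [abs_neg, abs_of_pos (by positivity)]; linarith)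
    rw [Real.norm_eq_abs, abs_le, le_div_iff₀ hε, ← neg_div, div_le_iff₀ hε]
    constructor <;> nlinarith
  have hYae : ∀ᵐ y ∂η, ∀ i, 0 ≤ 1 + ∑ j, (H i j - h j) * y j := hηsupp
  have hint : Integrable (fun y : Fin (d - 1) → ℝ => y) η := by
    apply Integrable.of_bound (C := 2 / ε) measurable_id.aestronglyMeasurable
    filter_upwards [hYae] with y hy using hYbd y hy
  have hmj : ∀ j, ∫ y, y j ∂η = 0 := by
    intro j
    have := eval_integral (μ := η) (f := fun (y : Fin (d - 1) → ℝ) => y)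
      (fun i => (hint.eval i)) j
    rw [← this, hηmean]
    rfl
  have hintl : ∀ j, Integrable (fun y : Fin (d - 1) → ℝ => h j * y j) η :=
    fun j => (hint.eval j).const_mul _
  have hintu : Integrable (fun y : Fin (d - 1) → ℝ => 1 - ∑ j, h j * y j) η :=
    (integrable_const _).sub (integrable_finsetSum _ fun j _ => hintl j)
  have hu1 : ∫ y, (1 - ∑ j, h j * y j) ∂η = 1 := by
    rw [integral_sub (integrable_const _) (integrable_finsetSum _ fun j _ => hintl j),
      integral_finsetSum _ fun j _ => hintl j]
    simp [integral_const_mul, hmj]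
  have mu0 : Measurable fun y : Fin (d - 1) → ℝ => 1 - ∑ j, h j * y j := by fun_prop
  have mv0 : Measurable fun y : Fin (d - 1) → ℝ => 1 + ∑ j, h j * y j := by fun_prop
  have mu := mu0.ennreal_ofReal
  have mv := mv0.ennreal_ofReal
  have mS : Measurable S := mu0.inv.smul measurable_id
  have mT : Measurable T := mv0.inv.smul measurable_id
  have hdotS : ∀ (k y : Fin (d - 1) → ℝ), ∑ j, k j * S y j
      = (1 - ∑ j, h j * y j)⁻¹ * ∑ j, k j * y j := by
    intro k y
    simp only [S, Pi.smul_apply, smul_eq_mul, Finset.mul_sum]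
    exact Finset.sum_congr rfl fun j _ => by ring
  have hdotT : ∀ (k y : Fin (d - 1) → ℝ), ∑ j, k j * T y j
      = (1 + ∑ j, h j * y j)⁻¹ * ∑ j, k j * y j := by
    intro k y
    simp only [T, Pi.smul_apply, smul_eq_mul, Finset.mul_sum]
    exact Finset.sum_congr rfl fun j _ => by ring
  have hvS : ∀ y, 0 < 1 - ∑ j, h j * y j →
      1 + ∑ j, h j * S y j = (1 - ∑ j, h j * y j)⁻¹ := by
    intro y hy
    rw [hdotS]
    field_simp
    ring
  have huT : ∀ x, 0 < 1 + ∑ j, h j * x j →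
      1 - ∑ j, h j * T x j = (1 + ∑ j, h j * x j)⁻¹ := by
    intro y hy
    rw [hdotT]
    field_simp
    ring
  refine ⟨⟨?_⟩, ?_, ?_, ?_, ?_⟩
  · rw [Measure.map_apply mS MeasurableSet.univ, Set.preimage_univ,
      withDensity_apply _ MeasurableSet.univ, Measure.restrict_univ,
      ← ofReal_integral_eq_lintegral_ofReal hintu, hu1, ENNReal.ofReal_one]
    filter_upwards [hYae] with y hy using (hYpos y hy).le
  · have mX : MeasurableSet 𝒳 := by
      have : 𝒳 = ⋂ i, {x | 0 ≤ 1 + ∑ j, H i j * x j} := by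
        ext x
        simp [𝒳]
      rw [this]
      exact MeasurableSet.iInter fun i => measurableSet_le measurable_const (by fun_prop)
    rw [Measure.map_apply mS mX.compl]
    apply withDensity_absolutelyContinuous
    have : ∀ᵐ y ∂η, S y ∈ 𝒳 := by
      filter_upwards [hYae] with y hy
      intro i
      have hp := hYpos y hy
      have a := hy i
      rw [hsplit y (H i)] at a
      rw [hdotS (H i)]
      have : 1 + (1 - ∑ j, h j * y j)⁻¹ * ∑ j, H i j * y j
        = (1 - ∑ j, h j * y j)⁻¹ * ((1 - ∑ j, h j * y j) + ∑ j, H i j * y j) := by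
        rw [mul_add, inv_mul_cancel₀ hp.ne']
      rw [this]
      positivity
    exact this
  · rw [integral_map (f := fun x => x) mS.aemeasurable measurable_id.aestronglyMeasurable,
      integral_withDensity_eq_integral_toReal_smul mu (by simp), ← hηmean]
    apply integral_congr_ae
    filter_upwards [hYae] with y hy
    have hp := hYpos y hy
    simp only [S]
    rw [ENNReal.toReal_ofReal hp.le, smul_smul, mul_inv_cancel₀ hp.ne', one_smul]
  · apply roundtrip_aux η _ _ S T mu mv mS mT
    · filter_upwards [hYae] with y hy
      have hp := hYpos y hy
      simp only [T]
      rw [hvS y hp, inv_inv]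
      simp only [S]
      rw [smul_smul, mul_inv_cancel₀ hp.ne', one_smul]
    · filter_upwards [hYae] with y hy
      have hp := hYpos y hy
      rw [hvS y hp, ← ENNReal.ofReal_mul hp.le, mul_inv_cancel₀ hp.ne', ENNReal.ofReal_one]
  · intro ρ' _ hsupp _ hfib
    have hXae : ∀ᵐ x ∂ρ', x ∈ 𝒳 := hsupp
    have := roundtrip_aux ρ' _ _ T S mv mu mT mS ?_ ?_
    · rw [← this]
      simp only [ρ]
      rw [← hfib]
    · filter_upwards [hXae] with x hx
      have hp := hXpos x hx
      simp only [S]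
      rw [huT x hp, inv_inv]
      simp only [T]
      rw [smul_smul, mul_inv_cancel₀ hp.ne', one_smul]
    · filter_upwards [hXae] with x hx
      have hp := hXpos x hx
      rw [huT x hp, ← ENNReal.ofReal_mul hp.le, mul_inv_cancel₀ hp.ne', ENNReal.ofReal_one]
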